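/- Let k ≥ 0, ℓ ≥ 1 and λ ∈ P_ℓ^k. If x ∈ [1, bot_λ − 1] and k > λ_x = λ_{x+1}, then Δ^k(λ) has a mirror in rows x, x+1: there exists c ∈ [x+2, ℓ−1] such that (x, c) and (x+1, c+1) are both removable roots of Δ^k(λ). -/

import Mathlib

open scoped Classical

noncomputable section

/-- The ambient ring: formal power series over ℚ in countably many variables. -/
abbrev R : Type := MvPowerSeries ℕ ℚ

/-- The complete homogeneous symmetric function `h_m` (equal to `0` for `m < 0`):
its coefficient at a monomial is `1` if the monomial has total degree `m`, else `0`. -/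
def hh (m : ℤ) : R := fun d => if ((d.sum fun _ e => (e : ℤ)) = m) then 1 else 0

/-- The inhomogeneous analogue `k_m^{(r)} = ∑_{i=0}^{m} C(r+i−1, i) · h_{m−i}`. -/
def kk (r : ℕ) (m : ℤ) : R :=
  ∑ i ∈ Finset.range (m.toNat + 1), ((r + i - 1).choose i : ℚ) • hh (m - (i : ℤ))

/-- The dual stable Grothendieck polynomial `g_γ`, as an `ℓ × ℓ` determinant with
`(i,j)` entry `k_{γ_i + j − i}^{(i−1)}` (indices 1-based). -/
def gg (ℓ : ℕ) (γ : ℕ → ℤ) : R :=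
  (Matrix.of fun i j : Fin ℓ =>
    kk i.val (γ (i.val + 1) + (j.val : ℤ) - (i.val : ℤ))).det

/-- The `i`-th standard basis vector `ε_i`. -/
def eps (i : ℕ) : ℕ → ℤ := fun x => if x = i then 1 else 0

/-- The Katalan function `K(Ψ; M; γ)`. -/
def katalan (ℓ : ℕ) (Ψ : Finset (ℕ × ℕ)) (M : Multiset ℕ) (γ : ℕ → ℤ) : R :=
  (M.powerset.map fun S =>
    (-1 : R) ^ Multiset.card S *
      ∑ᶠ α : {p // p ∈ Ψ} → ℕ,
        gg ℓ (fun x =>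
          γ x + (∑ p ∈ Ψ.attach, (α p : ℤ) * (eps p.1.1 x - eps p.1.2 x))
            - (S.map fun z => eps z x).sum)).sum

/-- The set of positive roots `Δ_ℓ^+ = {(i,j) : 1 ≤ i < j ≤ ℓ}`. -/
def DeltaPlus (ℓ : ℕ) : Finset (ℕ × ℕ) :=
  (Finset.Icc 1 ℓ ×ˢ Finset.Icc 1 ℓ).filter fun p => p.1 < p.2

/-- A root ideal: an upper order ideal of `Δ_ℓ^+`. -/
def IsRootIdeal (ℓ : ℕ) (Ψ : Finset (ℕ × ℕ)) : Prop :=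
  Ψ ⊆ DeltaPlus ℓ ∧
    ∀ a b c d : ℕ, (a, b) ∈ Ψ → (c, d) ∈ DeltaPlus ℓ → c ≤ a → b ≤ d → (c, d) ∈ Ψ

/-- The root ideal `Δ^k(λ) = {(i,j) ∈ Δ_ℓ^+ : j > k − λ_i + i}`. -/
def DeltaK (k ℓ : ℕ) (lam : ℕ → ℤ) : Finset (ℕ × ℕ) :=
  (DeltaPlus ℓ).filter fun p => (k : ℤ) - lam p.1 + (p.1 : ℤ) < (p.2 : ℤ)

/-- `bot(Ψ)`: the largest `x` such that row `x` of `Ψ` is nonempty (`0` if `Ψ = ∅`). -/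
def botIdeal (Ψ : Finset (ℕ × ℕ)) : ℕ := Ψ.sup Prod.fst

/-- `bot_λ := bot(Δ^k(λ))`. -/
def botL (k ℓ : ℕ) (lam : ℕ → ℤ) : ℕ := botIdeal (DeltaK k ℓ lam)

/-- A removable root of a root ideal. -/
def IsRemovable (ℓ : ℕ) (Ψ : Finset (ℕ × ℕ)) (α : ℕ × ℕ) : Prop :=
  α ∈ Ψ ∧ IsRootIdeal ℓ (Ψ.erase α)

/-- `down_Ψ(x)` is defined, i.e. row `x` of `Ψ` contains a removable root. -/
def HasDown (ℓ : ℕ) (Ψ : Finset (ℕ × ℕ)) (x : ℕ) : Prop :=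
  ∃ j, IsRemovable ℓ Ψ (x, j)

/-- `down_Ψ(x)`: the column of the removable root in row `x` (junk value `0` if
row `x` has no removable root). -/
def down (ℓ : ℕ) (Ψ : Finset (ℕ × ℕ)) (x : ℕ) : ℕ :=
  ((Ψ.filter fun p => p.1 = x ∧ IsRemovable ℓ Ψ p).image Prod.snd).sup id

/-- `down_λ := down_{Δ^k(λ)}`. -/
def downL (k ℓ : ℕ) (lam : ℕ → ℤ) : ℕ → ℕ := down ℓ (DeltaK k ℓ lam)

/-- The `a`-fold iterate `down_Ψ^a(x)` is defined. -/
def DownIterDefined (ℓ : ℕ) (Ψ : Finset (ℕ × ℕ)) (a x : ℕ) : Prop :=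
  ∀ b < a, HasDown ℓ Ψ ((down ℓ Ψ)^[b] x)

/-- `L(ℛ)`: the multiset of second components of `ℛ`, with multiplicity. -/
def Lmul (ℛ : Finset (ℕ × ℕ)) : Multiset ℕ := ℛ.val.map Prod.snd

/-- `λ ∈ P_ℓ^k`: a `k`-bounded partition with `ℓ` parts allowed to be zero. -/
def IsKBounded (k ℓ : ℕ) (lam : ℕ → ℤ) : Prop :=
  lam 1 ≤ (k : ℤ) ∧ (∀ i, 1 ≤ i → i < ℓ → lam (i + 1) ≤ lam i) ∧ 0 ≤ lam ℓ

/-- The multiset `M_z(λ)`: `L(Δ^k(λ))` with one occurrence of `down_λ(x)` removed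
for each `x ∈ [z, bot_λ]`. -/
def Mz (k ℓ : ℕ) (lam : ℕ → ℤ) (z : ℕ) : Multiset ℕ :=
  Lmul (DeltaK k ℓ lam) - ((Finset.Icc z (botL k ℓ lam)).val.map (downL k ℓ lam))

/-- The `K`-`k`-Schur function of weight `z`: `ĝ_λ^{(z)} = K(Δ^k(λ); M_z(λ); λ)`. -/
def wkschur (k ℓ : ℕ) (lam : ℕ → ℤ) (z : ℕ) : R :=
  katalan ℓ (DeltaK k ℓ lam) (Mz k ℓ lam z) lam

/-- The `K`-`k`-Schur function `g_λ^{(k)} = K(Δ^k(λ); L(Δ^{k+1}(λ)); λ)`. -/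
def kkschur (k ℓ : ℕ) (lam : ℕ → ℤ) : R :=
  katalan ℓ (DeltaK k ℓ lam) (Lmul (DeltaK (k + 1) ℓ lam)) lam

/-- The closed `k`-Schur Katalan function `𝔤_λ^{(k)} = K(Δ^k(λ); L(Δ^k(λ)); λ)`. -/
def closedkschur (k ℓ : ℕ) (lam : ℕ → ℤ) : R :=
  katalan ℓ (DeltaK k ℓ lam) (Lmul (DeltaK k ℓ lam)) lam

/-- `|λ| = λ_1 + ⋯ + λ_ℓ`. -/
def psize (ℓ : ℕ) (lam : ℕ → ℤ) : ℤ := ∑ i ∈ Finset.Icc 1 ℓ, lam i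

theorem IsKBounded.antitone {k ℓ : ℕ} {lam : ℕ → ℤ} (hlam : IsKBounded k ℓ lam) {a b : ℕ}
    (ha : 1 ≤ a) (hab : a ≤ b) (hb : b ≤ ℓ) : lam b ≤ lam a := by
  induction b, hab using Nat.le_induction with
  | base => exact le_rfl
  | succ n hn ih => exact (hlam.2.1 n (ha.trans hn) hb).trans (ih (by omega))

theorem mem_DeltaK {k ℓ : ℕ} {lam : ℕ → ℤ} {i j : ℕ} :
    (i, j) ∈ DeltaK k ℓ lam ↔ 1 ≤ i ∧ i < j ∧ j ≤ ℓ ∧ (k : ℤ) - lam i + i < j := by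
  simp only [DeltaK, DeltaPlus, Finset.mem_filter, Finset.mem_product, Finset.mem_Icc]
  omega

/-- The leftmost root of a row of `Δ^k(λ)` is removable. -/
theorem isRemovable_DeltaK {k ℓ : ℕ} {lam : ℕ → ℤ} (hlam : IsKBounded k ℓ lam) {r c : ℕ}
    (hr : 1 ≤ r) (hrl : r ≤ ℓ) (hc : c ≤ ℓ) (hcr : (c : ℤ) = k - lam r + r + 1) :
    IsRemovable ℓ (DeltaK k ℓ lam) (r, c) := by
  have hrc : r < c := by
    have h1 := hlam.antitone le_rfl hr hrl
    have h2 := hlam.1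
    omega
  refine ⟨mem_DeltaK.2 ⟨hr, hrc, hc, by omega⟩,
    (Finset.erase_subset _ _).trans (Finset.filter_subset _ _), ?_⟩
  intro a b i j hab hij hia hbj
  obtain ⟨hne, hab⟩ := Finset.mem_erase.1 hab
  obtain ⟨ha, hab', hb, hlt⟩ := mem_DeltaK.1 hab
  simp only [DeltaPlus, Finset.mem_filter, Finset.mem_product, Finset.mem_Icc] at hij
  have hanti := hlam.antitone hij.1.1.1 hia (by omega)
  refine Finset.mem_erase.2 ⟨?_, mem_DeltaK.2 ⟨by omega, by omega, by omega, by omega⟩⟩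
  intro h
  obtain ⟨rfl, rfl⟩ := Prod.mk.inj h
  exact hne (Prod.ext (by simp only; omega) (by simp only; omega))

/-- if `x ∈ [bot_λ − 1]` and `k > λ_x = λ_{x+1}`, then `Δ^k(λ)` has a
mirror in rows `x, x+1`. -/
theorem statement13 (k ℓ : ℕ) (hℓ : 1 ≤ ℓ) (lam : ℕ → ℤ) (hlam : IsKBounded k ℓ lam)
    (x : ℕ) (hx : x ∈ Finset.Icc 1 (botL k ℓ lam - 1))
    (hk : lam x < (k : ℤ)) (heq : lam x = lam (x + 1)) :
    ∃ c ∈ Finset.Icc (x + 2) (ℓ - 1),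
      IsRemovable ℓ (DeltaK k ℓ lam) (x, c) ∧
      IsRemovable ℓ (DeltaK k ℓ lam) (x + 1, c + 1) := by
  rw [Finset.mem_Icc] at hx
  obtain ⟨⟨b, j⟩, hbj, hxb⟩ : ∃ p ∈ DeltaK k ℓ lam, x < p.1 :=
    Finset.lt_sup_iff.1 (show x < botL k ℓ lam by omega)
  obtain ⟨-, hlt, hj, hbot⟩ := mem_DeltaK.1 hbj
  have hanti := hlam.antitone (Nat.succ_pos x) hxb (by omega)
  obtain ⟨c, hc⟩ := Int.eq_ofNat_of_zero_le (show 0 ≤ (k : ℤ) - lam x + x + 1 by omega)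
  simp only [Nat.succ_eq_add_one] at hanti hxb
  refine ⟨c, Finset.mem_Icc.2 ⟨by omega, by omega⟩,
    isRemovable_DeltaK hlam hx.1 (by omega) (by omega) hc.symm,
    isRemovable_DeltaK hlam (by omega) (by omega) (by omega) (by push_cast; omega)⟩

end
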